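/- Let n ≥ 2 be an integer and L > n/2 a real number. Then ∫_0^1 (s^{2L−n}/(1−s^{2L})) · (∫_0^{arccos s} (2cos θ − 2s)^{n−2} (s + 1/s − 2cos θ) dθ) ds = (√π (n−2)!/8) · ∑_{k=1}^∞ Γ(Lk − n/2) Γ(Lk − (n−1)/2)/(Γ(Lk+1))² · (Lk + n(n−1)/2). -/

import Mathlib

open MeasureTheory Set

lemma beta_scaled_aux (u v a : ℝ) (hu : 0 < u) (hv : 0 < v) (ha : 0 < a) :
    ∫ x in (0:ℝ)..a, x ^ (u - 1) * (a - x) ^ (v - 1)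
      = a ^ (u + v - 1) * (Real.Gamma u * Real.Gamma v / Real.Gamma (u + v)) := by
  have h := Complex.betaIntegral_scaled (u : ℂ) (v : ℂ) ha
  rw [Complex.betaIntegral_eq_Gamma_mul_div _ _ (by simpa) (by simpa)] at h
  rw [← Complex.ofReal_inj]
  rw [← intervalIntegral.integral_ofReal]
  have e : (((a ^ (u + v - 1) * (Real.Gamma u * Real.Gamma v / Real.Gamma (u + v))) : ℝ) : ℂ)
     = (a : ℂ) ^ ((u:ℂ) + v - 1) * (Complex.Gamma u * Complex.Gamma v / Complex.Gamma (u + v)) := by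
    rw [Complex.ofReal_mul, Complex.ofReal_cpow ha.le]
    push_cast
    rw [← Complex.ofReal_add, Complex.Gamma_ofReal, Complex.Gamma_ofReal, Complex.Gamma_ofReal]
  rw [e, ← h]
  refine intervalIntegral.integral_congr fun x hx => ?_
  rw [uIcc_of_le ha.le] at hx
  rw [Complex.ofReal_mul, Complex.ofReal_cpow hx.1, Complex.ofReal_cpow (sub_nonneg.2 hx.2)]
  push_cast
  rfl

lemma beta_nat_aux (u a : ℝ) (m : ℕ) (hu : 0 < u) (ha : 0 < a) :
    ∫ x in (0:ℝ)..a, x ^ (u - 1) * (a - x) ^ m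
      = a ^ (u + m) * (Real.Gamma u * m.factorial / Real.Gamma (u + m + 1)) := by
  have h := beta_scaled_aux u (m + 1) a hu (by positivity) ha
  rw [Real.Gamma_nat_eq_factorial] at h
  rw [show u + m = u + (m + 1 : ℝ) - 1 by ring, show u + (m + 1 : ℝ) - 1 + 1 = u + (m + 1) by ring,
    ← h]
  simp [Real.rpow_natCast]

lemma beta_nat_int (u a : ℝ) (m : ℕ) (hu : 0 < u) :
    IntervalIntegrable (fun x : ℝ => x ^ (u - 1) * (a - x) ^ m) volume 0 a := by
  apply IntervalIntegrable.mul_continuousOn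
  · exact intervalIntegral.intervalIntegrable_rpow' (by linarith)
  · fun_prop

/-- Wallis integral with real exponent -/
lemma wallis_aux (a : ℝ) (ha : -1 < a) :
    ∫ θ in Ioo (0:ℝ) (Real.pi / 2), Real.cos θ ^ a
      = Real.sqrt Real.pi / 2 * Real.Gamma ((a + 1) / 2) / Real.Gamma (a / 2 + 1) := by
  have hb := beta_scaled_aux ((a+1)/2) (1/2) 1 (by linarith) (by norm_num) one_pos
  rw [Real.Gamma_one_half_eq, Real.one_rpow, one_mul, show (a+1)/2 + 1/2 = a/2+1 by ring] at hb
  have him : (fun θ : ℝ => Real.cos θ ^ 2) '' Ioo 0 (Real.pi/2) = Ioo 0 1 := by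
    ext y; constructor
    · rintro ⟨t, ⟨h0, h1⟩, rfl⟩
      have hc := Real.cos_pos_of_mem_Ioo ⟨by linarith [Real.pi_pos], h1⟩
      have hs := Real.sin_pos_of_pos_of_lt_pi h0 (by linarith [Real.pi_pos])
      simp only [mem_Ioo]
      constructor
      · positivity
      · nlinarith [Real.sin_sq_add_cos_sq t]
    · rintro ⟨h0, h1⟩
      refine ⟨Real.arccos (Real.sqrt y), ⟨?_, ?_⟩, ?_⟩
      · rw [Real.arccos_pos, Real.sqrt_lt' one_pos]; simpa
      · rw [Real.arccos_lt_pi_div_two]; exact Real.sqrt_pos.2 h0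
      · simp only
        rw [Real.cos_arccos (by linarith [Real.sqrt_nonneg y]) (Real.sqrt_le_one.2 h1.le),
          Real.sq_sqrt h0.le]
  have hcv := integral_image_eq_integral_abs_deriv_smul (s := Ioo 0 (Real.pi/2))
    (f := fun θ : ℝ => Real.cos θ ^ 2) (f' := fun θ => 2 * Real.cos θ * (- Real.sin θ))
    measurableSet_Ioo
    (fun x _ => by
      have := ((Real.hasDerivAt_cos x).pow 2).hasDerivWithinAt (s := Ioo 0 (Real.pi/2))
      simpa using! this)
    (by
      intro x hx y hy hxy
      simp only at hxy
      have hc := Real.cos_pos_of_mem_Ioo ⟨by linarith [Real.pi_pos, hx.1], hx.2⟩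
      have hc' := Real.cos_pos_of_mem_Ioo ⟨by linarith [Real.pi_pos, hy.1], hy.2⟩
      have := (pow_left_inj₀ hc.le hc'.le two_ne_zero).1 hxy
      exact Real.injOn_cos ⟨hx.1.le, by linarith [hx.2, Real.pi_pos]⟩
        ⟨hy.1.le, by linarith [hy.2, Real.pi_pos]⟩ this)
    (fun x => x ^ ((a+1)/2 - 1) * (1 - x) ^ (1/2 - 1 : ℝ))
  rw [him, ← integral_Ioc_eq_integral_Ioo, ← intervalIntegral.integral_of_le zero_le_one, hb] at hcv
  have : ∫ θ in Ioo (0:ℝ) (Real.pi / 2), |2 * Real.cos θ * (- Real.sin θ)| •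
      ((Real.cos θ ^ 2) ^ ((a+1)/2 - 1) * (1 - Real.cos θ ^ 2) ^ (1/2 - 1 : ℝ))
      = ∫ θ in Ioo (0:ℝ) (Real.pi / 2), 2 * Real.cos θ ^ a := by
    refine setIntegral_congr_fun measurableSet_Ioo fun t ht => ?_
    have hc := Real.cos_pos_of_mem_Ioo ⟨by linarith [Real.pi_pos, ht.1], ht.2⟩
    have hs := Real.sin_pos_of_pos_of_lt_pi ht.1 (by linarith [Real.pi_pos, ht.2])
    simp only [smul_eq_mul]
    rw [← Real.sin_sq, ← Real.rpow_natCast (Real.sin t), ← Real.rpow_natCast (Real.cos t),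
      ← Real.rpow_mul hc.le, ← Real.rpow_mul hs.le, mul_neg, abs_neg, abs_of_pos (by positivity)]
    push_cast
    rw [show (2:ℝ) * (1/2 - 1) = -1 by norm_num, Real.rpow_neg_one,
      show (2:ℝ) * ((a+1)/2 - 1) = a - 1 by ring, Real.rpow_sub_one hc.ne']
    field_simp
  rw [this, integral_const_mul] at hcv
  linear_combination -hcv/2

/-- inner integral in s -/
lemma inner_aux (m : ℕ) (x c : ℝ) (hx : (m + 2 : ℝ) < 2 * x) (hc : 0 < c) :
    IntervalIntegrable (fun s : ℝ => s ^ (2 * x - (m+2)) * ((2 * c - 2 * s) ^ m * (s + 1 / s - 2 * c)))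
      volume 0 c ∧
    ∫ s in (0:ℝ)..c, s ^ (2 * x - (m+2)) * ((2 * c - 2 * s) ^ m * (s + 1 / s - 2 * c))
      = 2 ^ m * m.factorial * Real.Gamma (2 * x - (m+2)) / Real.Gamma (2 * x + 1) *
        (((2*x-m-1)*(2*x-m-2) - 2*(2*x-m-2)*(2*x)) * c ^ (2 * x)
          + (2*x)*(2*x-1) * c ^ (2 * x - 2)) := by
  have i1 := (beta_nat_int (2*x-m) c m (by linarith)).const_mul (2^m)
  have i2 := (beta_nat_int (2*x-m-1) c m (by linarith)).const_mul (2^m * (2*c))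
  have i3 := (beta_nat_int (2*x-m-2) c m (by linarith)).const_mul (2^m)
  have hcong : EqOn (fun s : ℝ => 2^m * (s ^ (2*x-m-1) * (c - s) ^ m)
      - 2^m * (2*c) * (s ^ (2*x-m-1-1) * (c - s) ^ m) + 2^m * (s ^ (2*x-m-2-1) * (c - s) ^ m))
      (fun s : ℝ => s ^ (2 * x - (m+2)) * ((2 * c - 2 * s) ^ m * (s + 1 / s - 2 * c)))
      (uIoc 0 c) := by
    intro s hs
    rw [uIoc_of_le hc.le] at hs
    have h0 := hs.1
    simp only
    rw [show 2 * c - 2 * s = 2 * (c - s) by ring, mul_pow,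
      show 2*x-m-1-1 = 2*x-(m+2) by ring, show 2*x-m-2-1 = 2*x-(m+2)-1 by ring,
      show 2*x-m-1 = 2*x-(m+2)+1 by ring, Real.rpow_sub_one h0.ne', Real.rpow_add_one h0.ne']
    field_simp
    ring
  have b1 := beta_nat_aux (2*x-m) c m (by linarith) hc
  have b2 := beta_nat_aux (2*x-m-1) c m (by linarith) hc
  have b3 := beta_nat_aux (2*x-m-2) c m (by linarith) hc
  refine ⟨((i1.sub i2).add i3).congr hcong, ?_⟩
  have : ∫ s in (0:ℝ)..c, s ^ (2 * x - (m+2)) * ((2 * c - 2 * s) ^ m * (s + 1 / s - 2 * c))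
    = ∫ s in (0:ℝ)..c, (2^m * (s ^ (2*x-m-1) * (c - s) ^ m)
      - 2^m * (2*c) * (s ^ (2*x-m-1-1) * (c - s) ^ m) + 2^m * (s ^ (2*x-m-2-1) * (c - s) ^ m)) :=
    (intervalIntegral.integral_congr_ae (Filter.Eventually.of_forall fun s hs => hcong hs)).symm
  rw [this, intervalIntegral.integral_add (i1.sub i2) i3, intervalIntegral.integral_sub i1 i2,
    intervalIntegral.integral_const_mul, intervalIntegral.integral_const_mul,
    intervalIntegral.integral_const_mul, b1, b2, b3]
  have p : 0 < 2*x-m-2 := by linarith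
  have hm : (0:ℝ) ≤ m := by positivity
  have q1 : Real.Gamma (2*x-m-1) = (2*x-m-2) * Real.Gamma (2*x-m-2) := by
    rw [← Real.Gamma_add_one p.ne']; ring_nf
  have q2 : Real.Gamma (2*x-m) = (2*x-m-1) * Real.Gamma (2*x-m-1) := by
    rw [← Real.Gamma_add_one (by linarith)]; ring_nf
  have r1 : Real.Gamma (2*x) = (2*x-1) * Real.Gamma (2*x-1) := by
    rw [← Real.Gamma_add_one (by linarith)]; ring_nf
  have r2 : Real.Gamma (2*x+1) = (2*x) * Real.Gamma (2*x) := by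
    rw [← Real.Gamma_add_one (by linarith)]
  have g := Real.Gamma_pos_of_pos (show 0 < 2*x-1 by linarith)
  rw [show 2*x-m+m = 2*x by ring, show 2*x-m-1+m = 2*x-1 by ring, show 2*x-m-2+m = 2*x-2 by ring,
    show 2*x-2+1=2*x-1 by ring, show 2*x-1+1=2*x by ring, show 2*x-(m+2) = 2*x-m-2 by ring,
    q2, q1, r2, r1, show (2:ℝ)*x-2 = 2*x-1-1 by ring, Real.rpow_sub_one hc.ne', Real.rpow_sub_one hc.ne']
  have : 2*x-1 ≠ 0 := by linarith
  have : x ≠ 0 := by linarith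
  field_simp

lemma kernel_nonneg (m : ℕ) (e s c : ℝ) (h0 : 0 < s) (h1 : s ≤ c) (h2 : c ≤ 1) :
    0 ≤ s ^ e * ((2 * c - 2 * s) ^ m * (s + 1 / s - 2 * c)) := by
  have : 0 ≤ s + 1 / s - 2 * c := by
    have : s + 1 / s - 2 = (s - 1) ^ 2 / s := by field_simp; ring
    have h : 0 ≤ (s - 1) ^ 2 / s := by positivity
    linarith
  have h3 : 0 ≤ 2 * c - 2 * s := by linarith
  positivity

/-- the kernel as an extended nonnegative real function -/
noncomputable def kker (m : ℕ) (e : ℝ) (s θ : ℝ) : ENNReal :=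
  if s < Real.cos θ then
    ENNReal.ofReal (s ^ e * ((2 * Real.cos θ - 2 * s) ^ m * (s + 1 / s - 2 * Real.cos θ))) else 0

lemma kker_meas (m : ℕ) (e : ℝ) : Measurable (Function.uncurry (kker m e)) := by
  unfold kker Function.uncurry
  refine Measurable.ite ?_ ?_ measurable_const
  · exact measurableSet_lt measurable_fst (by fun_prop)
  · fun_prop

lemma stepA (m : ℕ) (e s : ℝ) (h0 : 0 < s) (h1 : s < 1) :
    ENNReal.ofReal (s ^ e * ∫ θ in (0:ℝ)..Real.arccos s,
        (2 * Real.cos θ - 2 * s) ^ m * (s + 1 / s - 2 * Real.cos θ))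
      = ∫⁻ θ in Ioo 0 (Real.pi/2), kker m e s θ := by
  have ha := Real.arccos_nonneg s
  have ha2 : Real.arccos s ≤ Real.pi / 2 := Real.arccos_le_pi_div_two.2 h0.le
  have key : ∀ θ ∈ Ioo 0 (Real.pi/2), (s < Real.cos θ ↔ θ < Real.arccos s) := by
    intro θ hθ
    rw [← Real.arccos_cos hθ.1.le (by linarith [hθ.2, Real.pi_pos])]
    rw [Real.cos_arccos (Real.neg_one_le_cos θ) (Real.cos_le_one θ)]
    exact (Real.strictAntiOn_arccos.lt_iff_gt ⟨Real.neg_one_le_cos θ, Real.cos_le_one θ⟩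
      ⟨by linarith, h1.le⟩).symm
  rw [← intervalIntegral.integral_const_mul, intervalIntegral.integral_of_le ha,
    integral_Ioc_eq_integral_Ioo, ofReal_integral_eq_lintegral_ofReal]
  · have : ∫⁻ θ in Ioo 0 (Real.pi/2), kker m e s θ = ∫⁻ θ in Ioo 0 (Real.pi/2),
        (Iio (Real.arccos s)).indicator (fun θ => ENNReal.ofReal
          (s ^ e * ((2 * Real.cos θ - 2 * s) ^ m * (s + 1 / s - 2 * Real.cos θ)))) θ := by
      refine setLIntegral_congr_fun measurableSet_Ioo fun θ hθ => ?_
      simp only [kker, indicator, mem_Iio, key θ hθ]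
    rw [this, setLIntegral_indicator measurableSet_Iio]
    congr 2
    ext t; simp only [mem_Ioo, mem_inter_iff, mem_Iio]
    constructor
    · rintro ⟨a, b⟩; exact ⟨b, a, by linarith⟩
    · rintro ⟨b, a, _⟩; exact ⟨a, b⟩
  · refine (ContinuousOn.integrableOn_Icc ?_).mono_set Ioo_subset_Icc_self
    fun_prop
  · refine (ae_restrict_iff' measurableSet_Ioo).2 (Filter.Eventually.of_forall fun θ hθ => ?_)
    have := (key θ ⟨hθ.1, by linarith [hθ.2]⟩).2 hθ.2
    exact kernel_nonneg m e s _ h0 this.le (Real.cos_le_one θ)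

lemma stepB (m : ℕ) (x θ : ℝ) (hx : (m + 2 : ℝ) < 2 * x) (hθ : θ ∈ Ioo 0 (Real.pi / 2)) :
    ∫⁻ s in Ioo (0:ℝ) 1, kker m (2 * x - (m+2)) s θ
      = ENNReal.ofReal (∫ s in (0:ℝ)..Real.cos θ, s ^ (2 * x - (m+2)) *
          ((2 * Real.cos θ - 2 * s) ^ m * (s + 1 / s - 2 * Real.cos θ))) ∧
    0 ≤ ∫ s in (0:ℝ)..Real.cos θ, s ^ (2 * x - (m+2)) *
          ((2 * Real.cos θ - 2 * s) ^ m * (s + 1 / s - 2 * Real.cos θ)) := by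
  have hc := Real.cos_pos_of_mem_Ioo ⟨by linarith [Real.pi_pos, hθ.1], hθ.2⟩
  have hc1 := Real.cos_le_one θ
  have hi := (inner_aux m x _ hx hc).1
  rw [intervalIntegrable_iff_integrableOn_Ioo_of_le hc.le] at hi
  rw [intervalIntegral.integral_of_le hc.le, integral_Ioc_eq_integral_Ioo]
  have nn : ∀ s ∈ Ioo 0 (Real.cos θ), 0 ≤ s ^ (2 * x - (m+2)) *
          ((2 * Real.cos θ - 2 * s) ^ m * (s + 1 / s - 2 * Real.cos θ)) :=
    fun s hs => kernel_nonneg m _ s _ hs.1 hs.2.le hc1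
  refine ⟨?_, setIntegral_nonneg measurableSet_Ioo nn⟩
  rw [ofReal_integral_eq_lintegral_ofReal hi
    ((ae_restrict_iff' measurableSet_Ioo).2 (Filter.Eventually.of_forall nn))]
  have : ∫⁻ s in Ioo 0 1, kker m (2 * x - (m+2)) s θ = ∫⁻ s in Ioo 0 1,
        (Iio (Real.cos θ)).indicator (fun s => ENNReal.ofReal
          (s ^ (2 * x - (m+2)) * ((2 * Real.cos θ - 2 * s) ^ m * (s + 1 / s - 2 * Real.cos θ)))) s := by
    refine setLIntegral_congr_fun measurableSet_Ioo fun s hs => ?_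
    simp only [kker, indicator, mem_Iio]
  rw [this, setLIntegral_indicator measurableSet_Iio]
  congr 2
  ext t; simp only [mem_Ioo, mem_inter_iff, mem_Iio]
  constructor
  · rintro ⟨a, b, _⟩; exact ⟨b, a⟩
  · rintro ⟨b, a⟩; exact ⟨a, b, by linarith⟩

lemma gamma_final (m : ℕ) (x : ℝ) (hx : (m + 2 : ℝ) < 2 * x) :
    2 ^ m * m.factorial * Real.Gamma (2 * x - (m+2)) / Real.Gamma (2 * x + 1) *
        (((2*x-m-1)*(2*x-m-2) - 2*(2*x-m-2)*(2*x)) *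
          (Real.sqrt Real.pi / 2 * Real.Gamma ((2 * x + 1) / 2) / Real.Gamma (2 * x / 2 + 1))
          + (2*x)*(2*x-1) *
          (Real.sqrt Real.pi / 2 * Real.Gamma ((2 * x - 2 + 1) / 2) /
            Real.Gamma ((2 * x - 2) / 2 + 1)))
    = Real.sqrt Real.pi * m.factorial / 8 * (Real.Gamma (x - (m + 2 : ℝ) / 2) *
        Real.Gamma (x - ((m + 2 : ℝ) - 1) / 2) /
                Real.Gamma (x + 1) ^ 2 * (x + (m + 2) * ((m + 2 : ℝ) - 1) / 2)) := by
  have hm : (0:ℝ) ≤ m := by positivity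
  have d1 := Real.Gamma_mul_Gamma_add_half (x - (m + 2 : ℝ) / 2)
  have d2 := Real.Gamma_mul_Gamma_add_half (x + 1/2)
  rw [show x + 1/2 + 1/2 = x + 1 by ring, show 2 * (x + 1/2) = 2*x+1 by ring] at d2
  rw [show x - (m + 2 : ℝ) / 2 + 1/2 = x - ((m + 2 : ℝ) - 1) / 2 by ring,
    show 2 * (x - (m + 2 : ℝ) / 2) = 2 * x - (m+2) by ring] at d1
  have pw : (2:ℝ) ^ (1 - (2 * x - (m + 2))) = 2 ^ (1 - (2*x+1)) * 2 ^ m * 8 := by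
    rw [show (1 - (2 * x - (m + 2)) : ℝ) = (1 - (2*x+1)) + m + (3:ℕ) by push_cast; ring,
      Real.rpow_add two_pos, Real.rpow_add two_pos, Real.rpow_natCast, Real.rpow_natCast]
    norm_num
  have g1 : Real.Gamma (x + 1) = x * Real.Gamma x := Real.Gamma_add_one (by linarith)
  have g2 : Real.Gamma (x + 1/2) = (x - 1/2) * Real.Gamma (x - 1/2) := by
    rw [← Real.Gamma_add_one (by linarith)]; ring_nf
  have hp : 0 < (2:ℝ) ^ (1 - (2*x+1)) := by positivity
  rw [pw] at d1
  rw [d1, show (2*x+1)/2 = x+1/2 by ring, show 2*x/2 = x by ring,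
    show (2*x-2+1)/2 = x-1/2 by ring, show (2*x-2)/2+1 = x by ring]
  have p1 := Real.Gamma_pos_of_pos (show 0 < x by linarith)
  have p2 := Real.Gamma_pos_of_pos (show 0 < x - 1/2 by linarith)
  have p3 := Real.Gamma_pos_of_pos (show 0 < 2*x+1 by linarith)
  have hpi : 0 < Real.sqrt Real.pi := Real.sqrt_pos.2 Real.pi_pos
  have x0 : 0 < x := by linarith
  have x1 : 0 < x - 1/2 := by linarith
  have d3 : Real.Gamma (2*x+1) =
      (x - 1/2) * Real.Gamma (x-1/2) * (x * Real.Gamma x) / (2 ^ (1 - (2*x+1)) * √Real.pi) := by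
    rw [← g1, ← g2, d2]; field_simp
  rw [d3, g1, g2]
  generalize (2:ℝ) ^ (1 - (2*x+1)) = w at *
  generalize Real.Gamma (x - 1/2) = G at *
  have : (2*x - 1) ≠ 0 := by linarith
  field_simp
  ring

lemma term_eval (m : ℕ) (x : ℝ) (hx : (m + 2 : ℝ) < 2 * x) :
    ∫⁻ s in Ioo (0:ℝ) 1, ENNReal.ofReal (s ^ (2 * x - (m+2)) * ∫ θ in (0:ℝ)..Real.arccos s,
        (2 * Real.cos θ - 2 * s) ^ m * (s + 1 / s - 2 * Real.cos θ))
    = ENNReal.ofReal (Real.sqrt Real.pi * m.factorial / 8 * (Real.Gamma (x - (m + 2 : ℝ) / 2) *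
        Real.Gamma (x - ((m + 2 : ℝ) - 1) / 2) /
                Real.Gamma (x + 1) ^ 2 * (x + (m + 2) * ((m + 2 : ℝ) - 1) / 2))) := by
  have hm : (0:ℝ) ≤ m := by positivity
  rw [setLIntegral_congr_fun measurableSet_Ioo
    (fun s hs => stepA m (2 * x - (m+2)) s hs.1 hs.2),
    lintegral_lintegral_swap (kker_meas m _).aemeasurable,
    setLIntegral_congr_fun measurableSet_Ioo (fun θ hθ => (stepB m x θ hx hθ).1)]
  have i : ∀ a : ℝ, 0 ≤ a → IntegrableOn (fun θ => Real.cos θ ^ a) (Ioo 0 (Real.pi/2)) := by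
    intro a ha
    refine (Continuous.integrableOn_Icc ?_).mono_set Ioo_subset_Icc_self
    exact Real.continuous_cos.rpow_const (fun _ => Or.inr ha)
  have cg : EqOn (fun θ => ∫ s in (0:ℝ)..Real.cos θ, s ^ (2 * x - (m+2)) *
          ((2 * Real.cos θ - 2 * s) ^ m * (s + 1 / s - 2 * Real.cos θ)))
      (fun θ => 2 ^ m * m.factorial * Real.Gamma (2 * x - (m+2)) / Real.Gamma (2 * x + 1) *
        (((2*x-m-1)*(2*x-m-2) - 2*(2*x-m-2)*(2*x)) * Real.cos θ ^ (2 * x)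
          + (2*x)*(2*x-1) * Real.cos θ ^ (2 * x - 2))) (Ioo 0 (Real.pi/2)) := by
    intro θ hθ
    exact (inner_aux m x _ hx
      (Real.cos_pos_of_mem_Ioo ⟨by linarith [Real.pi_pos, hθ.1], hθ.2⟩)).2
  have j1 := (i (2*x) (by linarith)).const_mul ((2*x-m-1)*(2*x-m-2) - 2*(2*x-m-2)*(2*x))
  have j2 := (i (2*x-2) (by linarith)).const_mul ((2*x)*(2*x-1))
  have j3 := (j1.add j2).const_mul
    (2 ^ m * m.factorial * Real.Gamma (2 * x - (m+2)) / Real.Gamma (2 * x + 1))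
  rw [← ofReal_integral_eq_lintegral_ofReal]
  · rw [setIntegral_congr_fun measurableSet_Ioo cg, integral_const_mul, integral_add j1 j2,
      integral_const_mul, integral_const_mul, wallis_aux _ (by linarith), wallis_aux _ (by linarith),
      gamma_final m x hx]
  · exact IntegrableOn.congr_fun j3 cg.symm measurableSet_Ioo
  · exact (ae_restrict_iff' measurableSet_Ioo).2 (Filter.Eventually.of_forall
      fun θ hθ => (stepB m x θ hx hθ).2)

/-- Closed-form evaluation of `K(L,1)` (proof of Theorem 3(c)): for `L > n/2`,
`∫₀¹ s^{2L-n}/(1-s^{2L}) ∫₀^{arccos s} (2cos θ - 2s)^{n-2}(s+1/s-2cos θ) dθ ds`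
equals `(√π (n-2)!/8) ∑_{k≥1} Γ(Lk-n/2)Γ(Lk-(n-1)/2)/Γ(Lk+1)² (Lk+n(n-1)/2)`. -/
theorem K_at_one_eval
    (n : ℕ) (hn : 2 ≤ n) (L : ℝ) (hL : (n : ℝ) / 2 < L) :
    (∫ s in (0 : ℝ)..1,
        s ^ (2 * L - n) / (1 - s ^ (2 * L)) *
          ∫ θ in (0 : ℝ)..Real.arccos s,
            (2 * Real.cos θ - 2 * s) ^ (n - 2) * (s + 1 / s - 2 * Real.cos θ))
      = Real.sqrt Real.pi * Nat.factorial (n - 2) / 8 *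
          ∑' k : ℕ+,
            Real.Gamma (L * k - (n : ℝ) / 2) * Real.Gamma (L * k - ((n : ℝ) - 1) / 2) /
                Real.Gamma (L * k + 1) ^ 2 *
              (L * k + n * ((n : ℝ) - 1) / 2) := by
  obtain ⟨m, rfl⟩ := Nat.exists_eq_add_of_le' hn
  simp only [Nat.add_sub_cancel]
  push_cast at hL ⊢
  have hm : (0:ℝ) ≤ m := by positivity
  have hL0 : 0 < L := by linarith
  rw [← tsum_mul_left]
  set G : ℝ → ℝ := fun s => ∫ θ in (0 : ℝ)..Real.arccos s,
            (2 * Real.cos θ - 2 * s) ^ m * (s + 1 / s - 2 * Real.cos θ) with hG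
  have hxk : ∀ k : ℕ+, (m + 2 : ℝ) < 2 * (L * k) := by
    intro k
    have : (1:ℝ) ≤ k := by exact_mod_cast one_le (a := k)
    nlinarith
  have Gnn : ∀ s ∈ Ioo (0:ℝ) 1, 0 ≤ G s := by
    intro s hs
    refine intervalIntegral.integral_nonneg (Real.arccos_nonneg s) fun θ hθ => ?_
    have h1 : s ≤ Real.cos θ := by
      rw [← Real.cos_arccos (show -1 ≤ s by linarith [hs.1]) hs.2.le]
      exact Real.cos_le_cos_of_nonneg_of_le_pi hθ.1 (Real.arccos_le_pi s) hθ.2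
    simpa using kernel_nonneg m 0 s _ hs.1 h1 (Real.cos_le_one θ)
  have GM : AEMeasurable G (volume.restrict (Ioo (0:ℝ) 1)) := by
    have h : Measurable (fun s => (∫⁻ θ in Ioo 0 (Real.pi/2), kker m 0 s θ).toReal) :=
      (Measurable.lintegral_prod_right' (kker_meas m 0)).ennreal_toReal
    refine ⟨_, h, (ae_restrict_iff' measurableSet_Ioo).2 (Filter.Eventually.of_forall
      fun s hs => ?_)⟩
    have := stepA m 0 s hs.1 hs.2
    simp only
    rw [← this, ENNReal.toReal_ofReal]
    · simp [hG]
    · rw [Real.rpow_zero, one_mul]; exact Gnn s hs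
  have p1 : ∀ s ∈ Ioo (0:ℝ) 1, s ^ (2 * L) < 1 := fun s hs =>
    Real.rpow_lt_one hs.1.le hs.2 (by linarith)
  rw [intervalIntegral.integral_of_le zero_le_one, integral_Ioc_eq_integral_Ioo,
    integral_eq_lintegral_of_nonneg_ae]
  · have : ∫⁻ s in Ioo (0:ℝ) 1, ENNReal.ofReal (s ^ (2 * L - (m + 2)) / (1 - s ^ (2 * L)) * G s)
      = ∫⁻ s in Ioo (0:ℝ) 1, ∑' k : ℕ+, ENNReal.ofReal (s ^ (2 * (L * k) - (m + 2)) * G s) := by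
      refine setLIntegral_congr_fun measurableSet_Ioo fun s hs => ?_
      have hq := p1 s hs
      have hs0 := hs.1
      have hq0 : 0 ≤ s ^ (2 * L) := by positivity
      have hs1 := (hasSum_geometric_of_lt_one hq0 hq).mul_left (s ^ (2 * L - (m + 2)) * G s)
      have hs2 : HasSum (fun k : ℕ+ => s ^ (2 * (L * k) - (m + 2)) * G s)
          (s ^ (2 * L - (m + 2)) / (1 - s ^ (2 * L)) * G s) := by
        rw [← Equiv.pnatEquivNat.symm.hasSum_iff]
        convert! hs1 using 1
        · ext k
          simp only [Function.comp, Equiv.pnatEquivNat_symm_apply, Nat.succPNat_coe]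
          rw [← Real.rpow_natCast, ← Real.rpow_mul hs0.le, mul_right_comm, ← Real.rpow_add hs0]
          congr 2
          push_cast; ring
        · ring

      rw [← hs2.tsum_eq, ENNReal.ofReal_tsum_of_nonneg _ hs2.summable]
      intro k
      exact mul_nonneg (by positivity) (Gnn s hs)
    rw [this, lintegral_tsum]
    · skip
      rw [ENNReal.tsum_toReal_eq]
      · refine tsum_congr fun k => ?_
        rw [term_eval m (L * k) (hxk k), ENNReal.toReal_ofReal]
        have h := hxk k
        have g1 := Real.Gamma_pos_of_pos (show 0 < L * k - (m + 2 : ℝ) / 2 by linarith)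
        have g2 := Real.Gamma_pos_of_pos (show 0 < L * k - ((m + 2 : ℝ) - 1) / 2 by linarith)
        have : 0 ≤ L * k + (m + 2) * ((m + 2 : ℝ) - 1) / 2 := by
          have : 0 ≤ (m + 2) * ((m + 2 : ℝ) - 1) / 2 := by
            have : 0 ≤ (m + 2 : ℝ) - 1 := by linarith
            positivity
          linarith
        positivity
      · intro k
        rw [term_eval m (L * k) (hxk k)]
        exact ENNReal.ofReal_ne_top
    · intro k
      exact ((by fun_prop : Measurable fun s : ℝ => s ^ (2 * (L * k) - (m + 2 : ℝ))).aemeasurable.mul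
        GM).ennreal_ofReal
  · refine (ae_restrict_iff' measurableSet_Ioo).2 (Filter.Eventually.of_forall fun s hs => ?_)
    have h1 := p1 s hs
    have h2 := Real.rpow_nonneg hs.1.le (2 * L - (m + 2))
    exact mul_nonneg (div_nonneg h2 (by linarith)) (Gnn s hs)
  · exact ((by fun_prop : Measurable fun s : ℝ =>
      s ^ (2 * L - (m + 2 : ℝ)) / (1 - s ^ (2 * L))).aemeasurable.mul GM).aestronglyMeasurable
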